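/- arXiv:1603.07073 — 6 statements merged into one kernel-verified Lean document; each statement's English description precedes it below -/
import Mathlib

section
/- Let E be a Banach space, let U and V be closed linear subspaces of E having central proximity maps A and B respectively, and suppose U + V is closed in E. Given z ∈ E, define the levelling sequence z₁ = z, z₂ₙ = z₂ₙ₋₁ − A z₂ₙ₋₁, z₂ₙ₊₁ = z₂ₙ − B z₂ₙ for n = 1, 2, …. Then the sequence ‖zₙ‖ is nonincreasing and converges to dist(z, U + V) = inf_{w ∈ U+V} ‖z − w‖. -/
open Filter Topology

/-- If `‖y + x‖ = ‖y - x‖` for all `x ∈ W`, a functional dominated by the norm can be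
replaced by one with the same value at `y` and the opposite values on `W`. -/
theorem exists_reflected_functional {E : Type*} [NormedAddCommGroup E] [NormedSpace ℝ E]
    (W : Submodule ℝ E) (y : E) (hy : ∀ x ∈ W, ‖y + x‖ = ‖y - x‖)
    (φ : E →ₗ[ℝ] ℝ) (hφ : ∀ x, φ x ≤ ‖x‖) :
    ∃ ψ : E →ₗ[ℝ] ℝ, (∀ x, ψ x ≤ ‖x‖) ∧ ψ y = φ y ∧ ∀ x ∈ W, ψ x = -φ x := by
  by_cases hyW : y ∈ W
  · have h0 : y = 0 := by
      have h := hy y hyW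
      rw [sub_self, norm_zero, norm_eq_zero, ← two_smul ℝ] at h
      simpa using h
    refine ⟨-φ, fun x => ?_, by simp [h0], fun x _ => rfl⟩
    simpa using hφ (-x)
  · let f : E →ₗ.[ℝ] ℝ := ⟨W, (-φ).domRestrict W⟩
    have hscale : ∀ (c : ℝ), ∀ x ∈ W, ‖c • y - x‖ = ‖x + c • y‖ := by
      intro c x hx
      rcases eq_or_ne c 0 with rfl | hc
      · simp
      · have h := hy (c⁻¹ • x) (W.smul_mem _ hx)
        calc ‖c • y - x‖ = ‖c • (y - c⁻¹ • x)‖ := by rw [smul_sub, smul_inv_smul₀ hc]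
          _ = ‖c • (y + c⁻¹ • x)‖ := by rw [norm_smul, norm_smul, h]
          _ = ‖x + c • y‖ := by rw [smul_add, smul_inv_smul₀ hc, add_comm]
    obtain ⟨g, hg, hgN⟩ := exists_extension_of_le_sublinear
      (f.supSpanSingleton y (φ y) hyW) (fun x => ‖x‖)
      (fun c hc x => by simp [norm_smul, abs_of_pos hc]) (fun x x' => norm_add_le x x') (by
        rintro ⟨v, hv⟩
        obtain ⟨x, hx, w, hw, rfl⟩ := Submodule.mem_sup.1 hv
        obtain ⟨c, rfl⟩ := Submodule.mem_span_singleton.1 hw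
        rw [LinearPMap.supSpanSingleton_apply_mk f y (φ y) hyW x hx c]
        have h := hφ (c • y - x)
        rw [hscale c x hx, map_sub, map_smul] at h
        change -φ x + c • φ y ≤ ‖x + c • y‖
        linarith)
    have hval : ∀ (x : E) (hx : x ∈ W) (c : ℝ), g (x + c • y) = -φ x + c • φ y := by
      intro x hx c
      have hmem : x + c • y ∈ (f.supSpanSingleton y (φ y) hyW).domain :=
        Submodule.mem_sup.2 ⟨x, hx, _, Submodule.mem_span_singleton.2 ⟨c, rfl⟩, rfl⟩
      exact (hg ⟨_, hmem⟩).trans (LinearPMap.supSpanSingleton_apply_mk f y (φ y) hyW x hx c)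
    exact ⟨g, hgN, by simpa using hval 0 W.zero_mem 1, fun x hx => by simpa using hval x hx 0⟩

/-- A functional nearly norming `y` nearly norms `y + a` as well, if `y` is central with respect
to a subspace containing `a` and the norm of `y + a` barely exceeds that of `y`. -/
theorem le_functional_apply_add {E : Type*} [NormedAddCommGroup E] [NormedSpace ℝ E]
    (W : Submodule ℝ E) (y a : E) (hy : ∀ x ∈ W, ‖y + x‖ = ‖y - x‖) (ha : a ∈ W)
    (φ : E →ₗ[ℝ] ℝ) (c M δ ε : ℝ) (hφ : ∀ x, φ x ≤ c * ‖x‖) (hc : 0 ≤ c)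
    (hφy : c * (M - δ) ≤ φ y) (hya : ‖y + a‖ ≤ M + ε) :
    c * (M - (2 * δ + ε)) ≤ φ (y + a) := by
  have h := hφ (y - a)
  rw [← hy a ha, map_sub] at h
  have h' := mul_le_mul_of_nonneg_left hya hc
  rw [map_add]
  linarith

/-- Almost annihilating functionals: along a sequence of alternating central reductions whose
norms are almost stationary, there is a functional of norm at most `K + 1` which is bounded by a
constant independent of `K` on both subspaces and is nearly `(K + 1) * M` at `y n`. -/
theorem exists_almost_annihilating {E : Type*} [NormedAddCommGroup E] [NormedSpace ℝ E]
    (W : ℕ → Submodule ℝ E) (hW : ∀ n, W (n + 2) = W n) (y : ℕ → E)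
    (hstep : ∀ n, y n - y (n + 1) ∈ W (n + 1))
    (hcentral : ∀ n, ∀ x ∈ W (n + 1), ‖y (n + 1) + x‖ = ‖y (n + 1) - x‖)
    (hanti : Antitone fun n => ‖y n‖) (M ε : ℝ) (hM : ∀ n, M ≤ ‖y n‖) (K : ℕ) :
    ∀ n, ‖y n‖ ≤ M + ε → ∃ φ σ : E →ₗ[ℝ] ℝ,
      (∀ x, φ x ≤ ‖x‖) ∧ (∀ x, σ x ≤ (K + 1) * ‖x‖) ∧
      M - (2 ^ K - 1) * ε ≤ φ (y n) ∧ (K + 1) * (M - (2 ^ K - 1) * ε) ≤ σ (y n) ∧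
      (∀ w ∈ W n, σ w - φ w ≤ ‖w‖) ∧ ∀ w ∈ W (n + 1), σ w ≤ ‖w‖ := by
  induction K with
  | zero =>
    intro n _
    obtain ⟨g, hg, hgy⟩ := exists_dual_vector'' ℝ (y n)
    have hgN : ∀ x, g x ≤ ‖x‖ := fun x =>
      (le_abs_self _).trans (by simpa using g.le_of_opNorm_le hg x)
    have hgy' : g (y n) = ‖y n‖ := hgy
    refine ⟨g.toLinearMap, g.toLinearMap, hgN, fun x => by simpa using hgN x, ?_, ?_,
      fun w _ => by simp, fun w _ => hgN w⟩
    · simpa [hgy'] using hM n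
    · simpa [hgy'] using hM n
  | succ K ih =>
    intro n hn
    obtain ⟨φ, σ, hφ, hσ, hφy, hσy, hd, hs⟩ := ih (n + 1) ((hanti n.le_succ).trans hn)
    obtain ⟨ψ, hψ, hψy, hψW⟩ :=
      exists_reflected_functional (W (n + 1)) (y (n + 1)) (hcentral n) φ hφ
    have hsum : y (n + 1) + (y n - y (n + 1)) = y n := by abel
    have hback : ∀ (c : ℝ) (χ : E →ₗ[ℝ] ℝ), 0 ≤ c → (∀ x, χ x ≤ c * ‖x‖) →
        c * (M - (2 ^ K - 1) * ε) ≤ χ (y (n + 1)) →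
        c * (M - (2 ^ (K + 1) - 1) * ε) ≤ χ (y n) := by
      intro c χ hc hχ hχy
      have h := le_functional_apply_add (W (n + 1)) (y (n + 1)) (y n - y (n + 1)) (hcentral n)
        (hstep n) χ c M _ ε hχ hc hχy (by rwa [hsum])
      rw [hsum] at h
      refine le_of_eq_of_le ?_ h
      ring
    have hK : (0 : ℝ) ≤ K + 1 := by positivity
    refine ⟨ψ, σ + ψ, hψ, fun x => ?_, ?_, ?_, fun w hw => ?_, fun w hw => ?_⟩
    · have h1 := hσ x
      have h2 := hψ x
      rw [LinearMap.add_apply]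
      push_cast
      linarith
    · simpa using hback 1 ψ zero_le_one (by simpa using hψ) (by rw [hψy, one_mul]; exact hφy)
    · have h1 := hback _ σ hK hσ hσy
      have h2 := hback 1 ψ zero_le_one (by simpa using hψ) (by rw [hψy, one_mul]; exact hφy)
      rw [LinearMap.add_apply]
      push_cast
      linarith
    · have h := hs w (by rwa [hW])
      simpa using h
    · have h := hd w hw
      rw [LinearMap.add_apply, hψW w hw]
      linarith

/-- If the sum of two closed subspaces of a Banach space is closed, its elements split with norm
control. -/
theorem exists_bounded_decomposition {E : Type*} [NormedAddCommGroup E] [NormedSpace ℝ E]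
    [CompleteSpace E] (U V : Submodule ℝ E) (hU : IsClosed (U : Set E))
    (hV : IsClosed (V : Set E)) (hUV : IsClosed ((U ⊔ V : Submodule ℝ E) : Set E)) :
    ∃ C > 0, ∀ w ∈ U ⊔ V, ∃ u ∈ U, ∃ v ∈ V, u + v = w ∧ ‖u‖ ≤ C * ‖w‖ ∧ ‖v‖ ≤ C * ‖w‖ := by
  have : CompleteSpace U := hU.completeSpace_coe
  have : CompleteSpace V := hV.completeSpace_coe
  have : CompleteSpace (U ⊔ V : Submodule ℝ E) := hUV.completeSpace_coe
  let f : (U × V) →L[ℝ] (U ⊔ V : Submodule ℝ E) :=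
    (U.subtypeL.coprod V.subtypeL).codRestrict (U ⊔ V)
      (fun p => Submodule.add_mem_sup p.1.2 p.2.2)
  have hf : Function.Surjective f := by
    rintro ⟨w, hw⟩
    obtain ⟨u, hu, v, hv, rfl⟩ := Submodule.mem_sup.1 hw
    exact ⟨(⟨u, hu⟩, ⟨v, hv⟩), rfl⟩
  obtain ⟨C, hC, h⟩ := f.exists_preimage_norm_le hf
  refine ⟨C, hC, fun w hw => ?_⟩
  obtain ⟨p, hp, hpn⟩ := h ⟨w, hw⟩
  exact ⟨p.1, p.1.2, p.2, p.2.2, congrArg Subtype.val hp,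
    (norm_fst_le p).trans hpn, (norm_snd_le p).trans hpn⟩

/-- The limit of the norms in an alternating central reduction is a lower bound for the distances
to elements of the closed sum. -/
theorem le_norm_sub_of_alternating_central {E : Type*} [NormedAddCommGroup E] [NormedSpace ℝ E]
    [CompleteSpace E] (W : ℕ → Submodule ℝ E) (hW : ∀ n, W (n + 2) = W n)
    (hclosed : ∀ n, IsClosed (W n : Set E))
    (hsum : IsClosed ((W 0 ⊔ W 1 : Submodule ℝ E) : Set E)) (y : ℕ → E)
    (hstep : ∀ n, y n - y (n + 1) ∈ W (n + 1))
    (hcentral : ∀ n, ∀ x ∈ W (n + 1), ‖y (n + 1) + x‖ = ‖y (n + 1) - x‖)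
    (hanti : Antitone fun n => ‖y n‖) (M : ℝ) (hlim : Tendsto (fun n => ‖y n‖) atTop (𝓝 M))
    (hmem : ∀ n, y n - y 0 ∈ W 0 ⊔ W 1) (w₀ : E) (hw₀ : w₀ ∈ W 0 ⊔ W 1) :
    M ≤ ‖y 0 - w₀‖ := by
  have hM : ∀ n, M ≤ ‖y n‖ := fun n => hanti.le_of_tendsto hlim n
  have hpair : ∀ n, W n ⊔ W (n + 1) = W 0 ⊔ W 1 := by
    intro n
    induction n with
    | zero => rfl
    | succ n ih => rw [hW, sup_comm, ih]
  obtain ⟨C, hC, hdec⟩ := exists_bounded_decomposition (W 0) (W 1) (hclosed 0) (hclosed 1) hsum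
  set R : ℝ := ‖y 0‖ + ‖y 0 - w₀‖ with hR
  have hbound : ∀ (K : ℕ) (ε : ℝ), 0 < ε →
      (K + 1) * (M - (2 ^ K - 1) * ε) ≤ (K + 1) * ‖y 0 - w₀‖ + 4 * (C * R) := by
    intro K ε hε
    obtain ⟨n, hn⟩ := (hlim.eventually (eventually_le_nhds (lt_add_of_pos_right M hε))).exists
    obtain ⟨φ, σ, hφ, hσ, -, hσy, hd, hs⟩ :=
      exists_almost_annihilating W hW y hstep hcentral hanti M ε hM K n hn
    have h2n : ∀ w ∈ W n, σ w ≤ 2 * ‖w‖ := fun w hw => by linarith [hd w hw, hφ w]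
    have h2s : ∀ w ∈ W (n + 1), σ w ≤ 2 * ‖w‖ := fun w hw => by
      linarith [hs w hw, norm_nonneg w]
    have h2 : (∀ w ∈ W 0, σ w ≤ 2 * ‖w‖) ∧ ∀ w ∈ W 1, σ w ≤ 2 * ‖w‖ := by
      clear hn hφ hσ hσy hd hs
      induction n with
      | zero => exact ⟨h2n, h2s⟩
      | succ n ih => exact ih (by rwa [hW] at h2s) h2n
    obtain ⟨u, hu, v, hv, huv, hun, hvn⟩ := hdec (y n - y 0 + w₀) (add_mem (hmem n) hw₀)
    have hwR : ‖y n - y 0 + w₀‖ ≤ R := by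
      have h : y n - y 0 + w₀ = y n - (y 0 - w₀) := by abel
      rw [h]
      exact (norm_sub_le _ _).trans (by linarith [hanti n.zero_le])
    have hyn : y n = (y 0 - w₀) + (u + v) := by rw [huv]; abel
    have hσsplit : σ (y n) = σ (y 0 - w₀) + (σ u + σ v) := by
      rw [hyn, map_add, map_add]
    have hCR := mul_le_mul_of_nonneg_left hwR hC.le
    linarith [hσ (y 0 - w₀), h2.1 u hu, h2.2 v hv]
  have hbound' : ∀ K : ℕ, (K + 1) * M ≤ (K + 1) * ‖y 0 - w₀‖ + 4 * (C * R) := by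
    intro K
    have hcont : Continuous fun ε : ℝ => ((K : ℝ) + 1) * (M - (2 ^ K - 1) * ε) := by fun_prop
    have ht : Tendsto (fun ε : ℝ => ((K : ℝ) + 1) * (M - (2 ^ K - 1) * ε)) (𝓝[>] 0)
        (𝓝 ((K + 1) * M)) := by
      simpa using (hcont.tendsto 0).mono_left nhdsWithin_le_nhds
    exact le_of_tendsto ht (eventually_mem_nhdsWithin.mono fun ε hε => hbound K ε hε)
  by_contra! hlt
  obtain ⟨K, hK⟩ := exists_nat_gt (4 * (C * R) / (M - ‖y 0 - w₀‖))
  rw [div_lt_iff₀ (sub_pos.2 hlt)] at hK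
  linarith [hbound' K]

/-- Golomb's theorem / convergence of the levelling algorithm.
Let `E` be a Banach space, `U`, `V` closed subspaces of `E` having central proximity
maps `A`, `B` respectively, and suppose `U + V` is closed. For `z ∈ E` define the
levelling sequence `z₁ = z`, `z₂ₙ = z₂ₙ₋₁ − A z₂ₙ₋₁`, `z₂ₙ₊₁ = z₂ₙ − B z₂ₙ`.
Then `‖zₙ‖` is nonincreasing and converges to `dist(z, U + V) = inf_{w ∈ U+V} ‖z − w‖`. -/
theorem stmt0 {E : Type*} [NormedAddCommGroup E] [NormedSpace ℝ E] [CompleteSpace E]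
    (U V : Submodule ℝ E) (hU : IsClosed (U : Set E)) (hV : IsClosed (V : Set E))
    (A B : E → E)
    (hAU : ∀ z, A z ∈ U) (hBV : ∀ z, B z ∈ V)
    (hAprox : ∀ z, ∀ u ∈ U, ‖z - A z‖ ≤ ‖z - u‖)
    (hBprox : ∀ z, ∀ v ∈ V, ‖z - B z‖ ≤ ‖z - v‖)
    (hAcentral : ∀ z, ∀ x ∈ U, ‖z - A z + x‖ = ‖z - A z - x‖)
    (hBcentral : ∀ z, ∀ x ∈ V, ‖z - B z + x‖ = ‖z - B z - x‖)
    (hUV : IsClosed ((U ⊔ V : Submodule ℝ E) : Set E))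
    (z : E) (zseq : ℕ → E) (hz1 : zseq 1 = z)
    (heven : ∀ n, 1 ≤ n → zseq (2 * n) = zseq (2 * n - 1) - A (zseq (2 * n - 1)))
    (hodd : ∀ n, 1 ≤ n → zseq (2 * n + 1) = zseq (2 * n) - B (zseq (2 * n))) :
    (∀ n, 1 ≤ n → ‖zseq (n + 1)‖ ≤ ‖zseq n‖) ∧
    Tendsto (fun n => ‖zseq n‖) atTop
      (𝓝 (Metric.infDist z ((U ⊔ V : Submodule ℝ E) : Set E))) := by
  let W : ℕ → Submodule ℝ E := fun n => if Even n then V else U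
  have hW0 : W 0 = V := by simp [W]
  have hW1 : W 1 = U := by simp [W]
  have hW : ∀ n, W (n + 2) = W n := fun n => by simp [W, Nat.even_add]
  have hclosed : ∀ n, IsClosed (W n : Set E) := by
    intro n
    by_cases h : Even n <;> simp [W, h, hU, hV]
  let y : ℕ → E := fun n => zseq (n + 1)
  have hy0 : y 0 = z := hz1
  have hkey : ∀ n, y n - y (n + 1) ∈ W (n + 1) ∧
      ∀ x ∈ W (n + 1), ‖y (n + 1) + x‖ = ‖y (n + 1) - x‖ := by
    intro n
    obtain ⟨k, rfl | rfl⟩ := n.even_or_odd'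
    · have hWk : W (2 * k + 1) = U := by simp [W]
      have hyk : y (2 * k + 1) = y (2 * k) - A (y (2 * k)) := heven (k + 1) (by omega)
      rw [hWk, hyk, sub_sub_cancel]
      exact ⟨hAU _, hAcentral _⟩
    · have hWk : W (2 * k + 1 + 1) = V := by simp [W, Nat.even_add]
      have hyk : y (2 * k + 1 + 1) = y (2 * k + 1) - B (y (2 * k + 1)) :=
        hodd (k + 1) (by omega)
      rw [hWk, hyk, sub_sub_cancel]
      exact ⟨hBV _, hBcentral _⟩
  have hanti : Antitone fun n => ‖y n‖ := by
    refine antitone_nat_of_succ_le fun n => ?_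
    have hc := (hkey n).2 _ (hkey n).1
    rw [add_sub_cancel] at hc
    have h : (2 : ℝ) • y (n + 1) = y n + (y (n + 1) - (y n - y (n + 1))) := by
      rw [two_smul]; abel
    have h' := norm_add_le (y n) (y (n + 1) - (y n - y (n + 1)))
    rw [← h, norm_smul, ← hc, Real.norm_two] at h'
    linarith
  refine ⟨fun n hn => ?_, ?_⟩
  · obtain ⟨k, rfl⟩ := Nat.exists_eq_add_of_le' hn
    exact hanti k.le_succ
  have hsup : W 0 ⊔ W 1 = U ⊔ V := by rw [hW0, hW1, sup_comm]
  have hWle : ∀ n, W n ≤ W 0 ⊔ W 1 := by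
    intro n
    rw [hsup]
    by_cases h : Even n <;> simp [W, h]
  have hmem : ∀ n, y n - y 0 ∈ W 0 ⊔ W 1 := by
    intro n
    induction n with
    | zero => simp
    | succ n ih =>
      have h : y (n + 1) - y 0 = (y n - y 0) - (y n - y (n + 1)) := by abel
      rw [h]
      exact sub_mem ih (hWle _ (hkey n).1)
  have hlim := tendsto_atTop_ciInf hanti ⟨0, by rintro _ ⟨n, rfl⟩; exact norm_nonneg _⟩
  have hdist : ⨅ n, ‖y n‖ = Metric.infDist z ((U ⊔ V : Submodule ℝ E) : Set E) := by
    apply le_antisymm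
    · refine (Metric.le_infDist ⟨0, (U ⊔ V).zero_mem⟩).2 fun w hw => ?_
      rw [dist_eq_norm, ← hy0]
      exact le_norm_sub_of_alternating_central W hW hclosed (by rwa [hsup]) y
        (fun n => (hkey n).1) (fun n => (hkey n).2) hanti _ hlim hmem w (by rwa [hsup])
    · refine le_ciInf fun n => ?_
      have h : z - y n ∈ U ⊔ V := by
        rw [← neg_sub, ← hy0, ← hsup]
        exact neg_mem (hmem n)
      refine (Metric.infDist_le_dist_of_mem h).trans_eq ?_
      rw [dist_eq_norm, sub_sub_cancel]
  rw [hdist] at hlim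
  exact (tendsto_add_atTop_iff_nat 1).1 hlim
end

section
/- Let X be a compact sequential Hausdorff space, let A be a closed subalgebra of C(X) that contains the constants, let X₁ = X/R be the quotient space for the equivalence relation a ∼ b iff f(a) = f(b) for all f ∈ A, and let s : X → X₁ be the natural quotient map. Assume that for any two points x, y ∈ X with s(x) = s(y) and any sequence {xₙ} tending to x, there exists a sequence {yₙ} tending to y such that s(yₙ) = s(xₙ) for all n. Then for every h ∈ C(X) the functions f₁(a) = max_{x : s(x)=a} h(x) and f₂(a) = min_{x : s(x)=a} h(x) are continuous on X₁. -/
open Filter Topology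

/-- The equivalence relation on `X` induced by a subalgebra `A ⊆ C(X, ℝ)`:
`a ∼ b` iff `f a = f b` for all `f ∈ A`. -/
def algSetoid {X : Type*} [TopologicalSpace X] (A : Subalgebra ℝ C(X, ℝ)) : Setoid X where
  r a b := ∀ f ∈ A, (f : C(X, ℝ)) a = f b
  iseqv := ⟨fun _ _ _ => rfl, fun h f hf => (h f hf).symm,
    fun h₁ h₂ f hf => (h₁ f hf).trans (h₂ f hf)⟩

/-- If a setoid on a compact sequential space has closed graph and convergent sequences can be
lifted along its classes, then fibrewise suprema of continuous functions are continuous on the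
quotient. -/
theorem continuous_sSup_image_fiber {X : Type*} [TopologicalSpace X] [CompactSpace X]
    [SequentialSpace X] (r : Setoid X) (hr : IsClosed {p : X × X | r p.1 p.2})
    (hlift : ∀ x y : X, r x y → ∀ u : ℕ → X, Tendsto u atTop (𝓝 x) →
      ∃ v : ℕ → X, Tendsto v atTop (𝓝 y) ∧ ∀ n, r (v n) (u n))
    (h : C(X, ℝ)) :
    Continuous (fun a : Quotient r => sSup (⇑h '' {x | Quotient.mk r x = a})) := by
  rw [isQuotientMap_quotient_mk'.continuous_iff]
  set g : X → ℝ := fun x => sSup (⇑h '' {y | Quotient.mk r y = Quotient.mk r x})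
  change Continuous g
  have hcompact (x : X) : IsCompact (⇑h '' {y | Quotient.mk r y = Quotient.mk r x}) := by
    refine (IsClosed.isCompact ?_).image h.continuous
    simp only [Quotient.eq]
    exact hr.preimage (f := fun y => (y, x)) (by fun_prop)
  have hle {x y : X} (hxy : r y x) : h y ≤ g x :=
    le_csSup (hcompact x).bddAbove ⟨y, Quotient.sound hxy, rfl⟩
  have hmax (x : X) : ∃ y, r y x ∧ h y = g x := by
    obtain ⟨y, hy, hyx⟩ := (hcompact x).sSup_mem ⟨h x, x, rfl, rfl⟩
    exact ⟨y, Quotient.exact hy, hyx⟩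
  have hclosed (b : ℝ) : IsClosed {x | b ≤ g x} := by
    have himage : {x | b ≤ g x} = Prod.snd '' {p : X × X | r p.1 p.2 ∧ b ≤ h p.1} := by
      ext x
      constructor
      · intro hx
        obtain ⟨y, hyx, hy⟩ := hmax x
        exact ⟨(y, x), ⟨hyx, hx.trans_eq hy.symm⟩, rfl⟩
      · rintro ⟨⟨y, x⟩, ⟨hyx, hy⟩, rfl⟩
        exact hy.trans (hle hyx)
    rw [himage]
    exact isClosedMap_snd_of_compactSpace _
      (hr.inter (isClosed_le continuous_const (h.continuous.comp continuous_fst)))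
  rw [continuous_iff_seqContinuous]
  intro u x hu
  refine tendsto_order.2 ⟨fun a ha => ?_, fun b hb => ?_⟩
  · obtain ⟨y, hyx, hy⟩ := hmax x
    obtain ⟨v, hv, hvu⟩ := hlift x y (r.symm hyx) u hu
    filter_upwards [((h.continuous.tendsto y).comp hv).eventually_const_lt (ha.trans_eq hy.symm)]
      with n hn
    exact lt_of_lt_of_le hn (hle (hvu n))
  · filter_upwards [hu ((hclosed b).isOpen_compl.mem_nhds (not_le.2 hb))] with n hn
    exact not_le.1 hn

theorem isClosed_graph_algSetoid {X : Type*} [TopologicalSpace X] (A : Subalgebra ℝ C(X, ℝ)) :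
    IsClosed {p : X × X | algSetoid A p.1 p.2} := by
  change IsClosed {p : X × X | ∀ f ∈ A, f p.1 = f p.2}
  simp only [Set.ofPred_forall]
  exact isClosed_iInter fun f => isClosed_iInter fun _ =>
    isClosed_eq (by fun_prop) (by fun_prop)

/-- Proposition 2.1. Let `X` be a compact sequential Hausdorff space,
`A` a closed subalgebra of `C(X)` containing the constants, `X₁ = X/R` the quotient
space by the relation `a ∼ b ↔ ∀ f ∈ A, f a = f b` and `s : X → X₁` the quotient map.
If for any `x, y` with `s x = s y` and any sequence `xₙ → x` there is a sequence
`yₙ → y` with `s yₙ = s xₙ` for all `n`, then for every `h ∈ C(X)` the functions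
`f₁ a = max_{s x = a} h x` and `f₂ a = min_{s x = a} h x` are continuous on `X₁`. -/
theorem stmt1 {X : Type*} [TopologicalSpace X] [CompactSpace X] [T2Space X]
    [SequentialSpace X]
    (A : Subalgebra ℝ C(X, ℝ)) (hA : IsClosed (A : Set C(X, ℝ)))
    (hlift : ∀ x y : X, Quotient.mk (algSetoid A) x = Quotient.mk (algSetoid A) y →
      ∀ u : ℕ → X, Tendsto u atTop (𝓝 x) →
        ∃ v : ℕ → X, Tendsto v atTop (𝓝 y) ∧
          ∀ n, Quotient.mk (algSetoid A) (v n) = Quotient.mk (algSetoid A) (u n))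
    (h : C(X, ℝ)) :
    Continuous (fun a : Quotient (algSetoid A) =>
      sSup (⇑h '' {x | Quotient.mk (algSetoid A) x = a})) ∧
    Continuous (fun a : Quotient (algSetoid A) =>
      sInf (⇑h '' {x | Quotient.mk (algSetoid A) x = a})) := by
  have hsup := continuous_sSup_image_fiber (algSetoid A) (isClosed_graph_algSetoid A)
    (fun x y hxy u hu => by
      obtain ⟨v, hv, hvu⟩ := hlift x y (Quotient.sound hxy) u hu
      exact ⟨v, hv, fun n => Quotient.exact (hvu n)⟩)
  refine ⟨hsup h, (hsup (-h)).neg.congr fun a => ?_⟩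
  rw [Real.sInf_def, ← Set.image_neg_eq_neg, Set.image_image]
  rfl
end

section
/- Assume X is a compact Hausdorff space, A₁ is a closed subalgebra of C(X) containing the constants that satisfies the C-property. Then for every h ∈ C(X), the function Fh ∈ A₁ is a best approximation to h from A₁, i.e., ‖h − Fh‖ = inf_{w ∈ A₁} ‖h − w‖; in particular ‖h − Fh‖ ≤ ‖h − w‖ for every w ∈ A₁. -/
open Filter Topology

/-- `a ↦ max_{x : s x = a} h x` on the quotient space `X₁ = X/∼`. -/
noncomputable def Fsup {X : Type*} [TopologicalSpace X] (A : Subalgebra ℝ C(X, ℝ))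
    (h : X → ℝ) (a : Quotient (algSetoid A)) : ℝ :=
  sSup (h '' {x | Quotient.mk (algSetoid A) x = a})

/-- `a ↦ min_{x : s x = a} h x` on the quotient space `X₁ = X/∼`. -/
noncomputable def Finf {X : Type*} [TopologicalSpace X] (A : Subalgebra ℝ C(X, ℝ))
    (h : X → ℝ) (a : Quotient (algSetoid A)) : ℝ :=
  sInf (h '' {x | Quotient.mk (algSetoid A) x = a})

/-- The levelling operator `F`:
`(F h)(a) = ½ (max_{s x = a} h x + min_{s x = a} h x)`, regarded via the quotient map
`s = Quotient.mk` as a function on `X`. -/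
noncomputable def Fop {X : Type*} [TopologicalSpace X] (A : Subalgebra ℝ C(X, ℝ))
    (h : X → ℝ) (x : X) : ℝ :=
  (Fsup A h (Quotient.mk (algSetoid A) x) + Finf A h (Quotient.mk (algSetoid A) x)) / 2

/-- The `C`-property of a subalgebra `A ⊆ C(X, ℝ)`: for every `h ∈ C(X)` the functions
`a ↦ max_{s x = a} h x` and `a ↦ min_{s x = a} h x` are continuous on the quotient
space `X₁`. -/
def CProperty {X : Type*} [TopologicalSpace X] (A : Subalgebra ℝ C(X, ℝ)) : Prop :=
  ∀ h : C(X, ℝ), Continuous (Fsup A ⇑h) ∧ Continuous (Finf A ⇑h)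

/-- Every continuous function on the quotient pulls back to an element of the closed
subalgebra, by the Stone–Weierstrass theorem. -/
theorem comp_quotient_mk_mem {X : Type*} [TopologicalSpace X] [CompactSpace X]
    (A : Subalgebra ℝ C(X, ℝ)) (hA : IsClosed (A : Set C(X, ℝ)))
    (g : C(Quotient (algSetoid A), ℝ)) :
    g.comp ⟨Quotient.mk (algSetoid A), continuous_quotient_mk'⟩ ∈ A := by
  let s : C(X, Quotient (algSetoid A)) := ⟨Quotient.mk (algSetoid A), continuous_quotient_mk'⟩
  let B : Subalgebra ℝ C(Quotient (algSetoid A), ℝ) :=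
    A.comap (ContinuousMap.compRightAlgHom ℝ ℝ s)
  have hB : IsClosed (B : Set C(Quotient (algSetoid A), ℝ)) :=
    hA.preimage (ContinuousMap.continuous_precomp s)
  have hsep : B.SeparatesPoints := by
    intro a b
    induction a using Quotient.inductionOn with | _ a
    induction b using Quotient.inductionOn with | _ b
    intro hab
    have hne : ¬ ∀ f ∈ A, (f : C(X, ℝ)) a = f b := fun hf => hab (Quotient.sound hf)
    push Not at hne
    obtain ⟨f, hf, hfab⟩ := hne
    let f' : C(Quotient (algSetoid A), ℝ) :=
      ⟨Quotient.lift f fun _ _ hxy => hxy f hf, f.continuous.quotient_lift _⟩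
    have hf' : f' ∈ B := by
      change f'.comp s ∈ A
      exact hf
    exact ⟨f', ⟨f', hf', rfl⟩, hfab⟩
  have htop : B = ⊤ := by
    rw [← ContinuousMap.subalgebra_topologicalClosure_eq_top_of_separatesPoints B hsep]
    exact SetLike.coe_injective hB.closure_eq.symm
  have hg : g ∈ B := htop ▸ Algebra.mem_top
  exact hg

/-- The pointwise distance from `h` to its levelling is at most the distance from `h` to any
element of the subalgebra. -/
theorem abs_sub_Fop_le {X : Type*} [TopologicalSpace X] [CompactSpace X]
    (A : Subalgebra ℝ C(X, ℝ)) (h v : C(X, ℝ)) (hv : v ∈ A) (x : X) :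
    |h x - Fop A h x| ≤ ‖h - v‖ := by
  have hfib : ∀ y, Quotient.mk (algSetoid A) y = Quotient.mk (algSetoid A) x →
      |h y - v x| ≤ ‖h - v‖ := fun y hy => by
    have hvy : v y = v x := Quotient.exact hy v hv
    rw [← hvy]
    exact (h - v).norm_coe_le_norm y
  set S : Set ℝ := h '' {y | Quotient.mk (algSetoid A) y = Quotient.mk (algSetoid A) x}
  have hxS : h x ∈ S := ⟨x, rfl, rfl⟩
  have hub : v x + ‖h - v‖ ∈ upperBounds S := by
    rintro _ ⟨y, hy, rfl⟩
    linarith [(abs_le.mp (hfib y hy)).2]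
  have hlb : v x - ‖h - v‖ ∈ lowerBounds S := by
    rintro _ ⟨y, hy, rfl⟩
    linarith [(abs_le.mp (hfib y hy)).1]
  have h₁ : sSup S ≤ v x + ‖h - v‖ := csSup_le ⟨_, hxS⟩ hub
  have h₂ : v x - ‖h - v‖ ≤ sInf S := le_csInf ⟨_, hxS⟩ hlb
  have h₃ : h x ≤ sSup S := le_csSup ⟨_, hub⟩ hxS
  have h₄ : sInf S ≤ h x := csInf_le ⟨_, hlb⟩ hxS
  have hF : Fop A h x = (sSup S + sInf S) / 2 := rfl
  rw [hF, abs_le]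
  constructor <;> linarith

/-- Theorem 2.2, proximity. If `X` is compact Hausdorff and `A₁` is a
closed subalgebra of `C(X)` containing the constants satisfying the `C`-property, then
for every `h ∈ C(X)` the function `F h` belongs to `A₁` and is a best approximation to
`h` from `A₁`: `‖h − Fh‖ = inf_{w ∈ A₁} ‖h − w‖`, in particular `‖h − Fh‖ ≤ ‖h − w‖`
for every `w ∈ A₁`. -/
theorem stmt5 {X : Type*} [TopologicalSpace X] [CompactSpace X] [T2Space X]
    (A₁ : Subalgebra ℝ C(X, ℝ)) (hA₁ : IsClosed (A₁ : Set C(X, ℝ)))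
    (hC : CProperty A₁) (h : C(X, ℝ)) :
    ∃ w ∈ A₁, (∀ x, (w : C(X, ℝ)) x = Fop A₁ ⇑h x) ∧
      (∀ v ∈ A₁, ‖h - w‖ ≤ ‖h - v‖) ∧
      ‖h - w‖ = ⨅ v : A₁, ‖h - (v : C(X, ℝ))‖ := by
  let g : C(Quotient (algSetoid A₁), ℝ) :=
    ⟨fun a => (Fsup A₁ h a + Finf A₁ h a) / 2, ((hC h).1.add (hC h).2).div_const 2⟩
  have hw := comp_quotient_mk_mem A₁ hA₁ g
  have hbest : ∀ v ∈ A₁,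
      ‖h - g.comp ⟨Quotient.mk (algSetoid A₁), continuous_quotient_mk'⟩‖ ≤ ‖h - v‖ :=
    fun v hv => (ContinuousMap.norm_le _ (norm_nonneg _)).mpr fun x => abs_sub_Fop_le A₁ h v hv x
  refine ⟨_, hw, fun _ => rfl, hbest, le_antisymm (le_ciInf fun v => hbest v v.2) ?_⟩
  exact ciInf_le (f := fun v : A₁ => ‖h - (v : C(X, ℝ))‖)
    ⟨0, Set.forall_mem_range.mpr fun _ => norm_nonneg _⟩ ⟨_, hw⟩
end

section
/- Assume X is a compact Hausdorff space and A₁ is a closed subalgebra of C(X) containing the constants that satisfies the C-property. Then F is a central proximity map: for every h ∈ C(X) and every f ∈ A₁, ‖h − Fh − f‖ = ‖h − Fh + f‖. -/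
open Filter Topology

theorem isCompact_algSetoid_fiber {X : Type*} [TopologicalSpace X] [CompactSpace X]
    (A : Subalgebra ℝ C(X, ℝ)) (a : Quotient (algSetoid A)) :
    IsCompact {x | Quotient.mk (algSetoid A) x = a} := by
  induction a using Quotient.inductionOn with
  | h a =>
    have hset : {x | Quotient.mk (algSetoid A) x = Quotient.mk (algSetoid A) a} =
        ⋂ f ∈ A, {x | (f : C(X, ℝ)) x = f a} := by
      ext x
      simp only [Set.mem_ofPred_eq, Set.mem_iInter]
      exact Quotient.eq
    rw [hset]
    exact (isClosed_biInter fun f _ => isClosed_eq f.continuous continuous_const).isCompact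

/-- On each fibre, `h - F h` takes values in an interval symmetric about `0` and attains both
endpoints. -/
theorem exists_sub_Fop_bounds {X : Type*} [TopologicalSpace X] [CompactSpace X]
    (A : Subalgebra ℝ C(X, ℝ)) (h : C(X, ℝ)) (x : X) :
    ∃ r p q, |h x - Fop A h x| ≤ r ∧ (algSetoid A).r p x ∧ (algSetoid A).r q x ∧
      h p - Fop A h p = r ∧ h q - Fop A h q = -r := by
  set s := {y | Quotient.mk (algSetoid A) y = Quotient.mk (algSetoid A) x} with hs
  have hx : x ∈ s := rfl
  have hcomp : IsCompact (h '' s) :=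
    (isCompact_algSetoid_fiber A _).image h.continuous
  have hne : (h '' s).Nonempty := ⟨h x, x, hx, rfl⟩
  obtain ⟨p, hp, hpM⟩ := hcomp.sSup_mem hne
  obtain ⟨q, hq, hqm⟩ := hcomp.sInf_mem hne
  have hle : h x ≤ sSup (h '' s) := le_csSup hcomp.bddAbove ⟨x, hx, rfl⟩
  have hge : sInf (h '' s) ≤ h x := csInf_le hcomp.bddBelow ⟨x, hx, rfl⟩
  have hF : ∀ y ∈ s, Fop A h y = (sSup (h '' s) + sInf (h '' s)) / 2 := by
    intro y hy
    rw [hs, Set.mem_ofPred_eq] at hy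
    rw [Fop, hy, Fsup, Finf]
  refine ⟨(sSup (h '' s) - sInf (h '' s)) / 2, p, q, ?_, Quotient.exact hp, Quotient.exact hq,
    ?_, ?_⟩
  · rw [hF x hx, abs_le]
    constructor <;> linarith
  · rw [hF p hp, hpM]
    ring
  · rw [hF q hq, hqm]
    ring

theorem exists_abs_sub_Fop_sub_le {X : Type*} [TopologicalSpace X] [CompactSpace X]
    (A : Subalgebra ℝ C(X, ℝ)) (h f : C(X, ℝ)) (hf : f ∈ A) (x : X) :
    ∃ y, |h x - Fop A h x - f x| ≤ |h y - Fop A h y + f y| := by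
  obtain ⟨r, p, q, hr, hp, hq, hpr, hqr⟩ := exists_sub_Fop_bounds A h x
  have hsub := abs_sub (h x - Fop A h x) (f x)
  rcases le_total 0 (f x) with h0 | h0
  · refine ⟨p, ?_⟩
    rw [hpr, hp f hf]
    rw [abs_of_nonneg h0] at hsub
    exact (hsub.trans (by linarith)).trans (le_abs_self _)
  · refine ⟨q, ?_⟩
    rw [hqr, hq f hf]
    rw [abs_of_nonpos h0] at hsub
    exact (hsub.trans (by linarith)).trans (neg_le_abs _)

theorem CProperty.continuous_Fop {X : Type*} [TopologicalSpace X] {A : Subalgebra ℝ C(X, ℝ)}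
    (hC : CProperty A) (h : C(X, ℝ)) : Continuous (Fop A h) :=
  (((hC h).1.comp continuous_quotient_mk').add
    ((hC h).2.comp continuous_quotient_mk')).div_const 2

theorem CProperty.iSup_abs_sub_Fop_sub_le {X : Type*} [TopologicalSpace X] [CompactSpace X]
    {A : Subalgebra ℝ C(X, ℝ)} (hC : CProperty A) (h f : C(X, ℝ)) (hf : f ∈ A) :
    (⨆ x, |h x - Fop A h x - f x|) ≤ ⨆ x, |h x - Fop A h x + f x| := by
  have hcont : Continuous fun x => |h x - Fop A h x + f x| :=
    ((h.continuous.sub (hC.continuous_Fop h)).add f.continuous).abs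
  refine Real.iSup_le (fun x => ?_) (Real.iSup_nonneg fun _ => abs_nonneg _)
  obtain ⟨y, hy⟩ := exists_abs_sub_Fop_sub_le A h f hf x
  exact hy.trans (le_ciSup (isCompact_range hcont).bddAbove y)

/-- Theorem 2.2, centrality. If `X` is compact Hausdorff and `A₁` is a
closed subalgebra of `C(X)` containing the constants satisfying the `C`-property, then
`F` is a central proximity map: `‖h − Fh − f‖ = ‖h − Fh + f‖` for every `h ∈ C(X)` and
every `f ∈ A₁` (sup norms). -/
theorem stmt6 {X : Type*} [TopologicalSpace X] [CompactSpace X] [T2Space X]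
    (A₁ : Subalgebra ℝ C(X, ℝ)) (hA₁ : IsClosed (A₁ : Set C(X, ℝ)))
    (hC : CProperty A₁) (h : C(X, ℝ)) (f : C(X, ℝ)) (hf : f ∈ A₁) :
    (⨆ x, |h x - Fop A₁ ⇑h x - f x|) = ⨆ x, |h x - Fop A₁ ⇑h x + f x| := by
  refine le_antisymm (hC.iSup_abs_sub_Fop_sub_le h f hf) ?_
  simpa [sub_eq_add_neg] using hC.iSup_abs_sub_Fop_sub_le h (-f) (neg_mem hf)
end

section
/- Let X be a compact Hausdorff space, A₁, A₂ closed subalgebras of C(X) containing the constants, and l = {x₁, …, xₙ} a bolt with respect to (A₁, A₂). Then for every f belonging to A₁ or to A₂, the bolt functional satisfies |r_l(f)| ≤ (2/n) ‖f‖. -/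
open Filter Topology

/-- `x` and `y` are identified by the algebra `A ⊆ C(X, ℝ)`: `f x = f y` for all
`f ∈ A`.  For the algebra `A₁` this is the relation `s x = s y`, for `A₂` it is
`p x = p y`, where `s, p` are the natural quotient maps. -/
def algRel {X : Type*} [TopologicalSpace X] (A : Subalgebra ℝ C(X, ℝ)) (x y : X) : Prop :=
  ∀ f ∈ A, (f : C(X, ℝ)) x = f y

/-- A bolt (of lightning) with respect to `(A₁, A₂)`: a finite ordered set
`x 0, x 1, …, x (n-1)` of points of `X` with consecutive points distinct, such that
consecutive points are alternately identified by `A₁` and by `A₂` (starting with either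
`A₁` or `A₂`). -/
def IsBolt {X : Type*} [TopologicalSpace X] (A₁ A₂ : Subalgebra ℝ C(X, ℝ))
    (n : ℕ) (x : ℕ → X) : Prop :=
  (∀ i, i + 1 < n → x i ≠ x (i + 1)) ∧
  ((∀ i, i + 1 < n →
      if Even i then algRel A₁ (x i) (x (i + 1)) else algRel A₂ (x i) (x (i + 1))) ∨
   (∀ i, i + 1 < n →
      if Even i then algRel A₂ (x i) (x (i + 1)) else algRel A₁ (x i) (x (i + 1))))

/-- A closed bolt: a bolt with an even number of points which remains a bolt when the
first point is appended again at the end. -/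
def IsClosedBolt {X : Type*} [TopologicalSpace X] (A₁ A₂ : Subalgebra ℝ C(X, ℝ))
    (n : ℕ) (x : ℕ → X) : Prop :=
  IsBolt A₁ A₂ n x ∧ Even n ∧ IsBolt A₁ A₂ (n + 1) (fun i => if i < n then x i else x 0)

/-- An alternating sum whose terms `2 k` and `2 k + 1` agree telescopes to at most one term. -/
lemma alternating_sum_of_eq_succ_of_even {n : ℕ} {a : ℕ → ℝ}
    (h : ∀ i, i + 1 < n → Even i → a i = a (i + 1)) (m : ℕ) (hm : m < n) :
    ∑ i ∈ Finset.range (m + 1), (-1 : ℝ) ^ i * a i = if Even m then a m else 0 := by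
  induction m with
  | zero => simp
  | succ k ih =>
    rw [Finset.sum_range_succ, ih (by omega)]
    by_cases hk : Even k
    · have hk' : ¬ Even (k + 1) := by simpa [Nat.even_add_one] using hk
      simp [hk, hk', (Nat.not_even_iff_odd.1 hk').neg_one_pow, h k hm hk]
    · have hk' : Even (k + 1) := by simpa [Nat.even_add_one] using hk
      simp [hk, hk', hk'.neg_one_pow]

/-- An alternating sum whose terms `2 k + 1` and `2 k + 2` agree telescopes to its first and
possibly its last term. -/
lemma alternating_sum_of_eq_succ_of_odd {n : ℕ} {a : ℕ → ℝ}
    (h : ∀ i, i + 1 < n → ¬ Even i → a i = a (i + 1)) (m : ℕ) (hm : m < n) :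
    ∑ i ∈ Finset.range (m + 1), (-1 : ℝ) ^ i * a i = if Even m then a 0 else a 0 - a m := by
  induction m with
  | zero => simp
  | succ k ih =>
    rw [Finset.sum_range_succ, ih (by omega)]
    by_cases hk : Even k
    · have hk' : ¬ Even (k + 1) := by simpa [Nat.even_add_one] using hk
      simp [hk, hk', (Nat.not_even_iff_odd.1 hk').neg_one_pow, sub_eq_add_neg]
    · have hk' : Even (k + 1) := by simpa [Nat.even_add_one] using hk
      simp [hk, hk', hk'.neg_one_pow, h k hm hk]

/-- An alternating sum of terms bounded by `M`, in which every second pair of consecutive terms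
agree, is bounded by `2 * M`. -/
lemma abs_alternating_sum_le {n : ℕ} (hn : 1 ≤ n) {a : ℕ → ℝ} {M : ℝ} (hM : ∀ i, |a i| ≤ M)
    (h : (∀ i, i + 1 < n → Even i → a i = a (i + 1)) ∨
      (∀ i, i + 1 < n → ¬ Even i → a i = a (i + 1))) :
    |∑ i ∈ Finset.range n, (-1 : ℝ) ^ i * a i| ≤ 2 * M := by
  obtain ⟨m, rfl⟩ := Nat.exists_eq_add_of_le' hn
  have h₀ := abs_le.1 (hM 0)
  have hm := abs_le.1 (hM m)
  rcases h with h | h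
  · rw [alternating_sum_of_eq_succ_of_even h m (by omega), abs_le]
    split_ifs <;> constructor <;> linarith
  · rw [alternating_sum_of_eq_succ_of_odd h m (by omega), abs_le]
    split_ifs <;> constructor <;> linarith

/-- Let `X` be compact Hausdorff, `A₁, A₂` closed subalgebras of
`C(X)` containing the constants, and `l = {x 0, …, x (n-1)}` a bolt with respect to
`(A₁, A₂)`.  Then for every `f` belonging to `A₁` or to `A₂`,
`|r_l(f)| ≤ (2/n) ‖f‖`. -/
theorem stmt12 {X : Type*} [TopologicalSpace X] [CompactSpace X] [T2Space X]
    (A₁ A₂ : Subalgebra ℝ C(X, ℝ))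
    (hA₁ : IsClosed (A₁ : Set C(X, ℝ))) (hA₂ : IsClosed (A₂ : Set C(X, ℝ)))
    (n : ℕ) (hn : 1 ≤ n) (x : ℕ → X) (hbolt : IsBolt A₁ A₂ n x)
    (f : C(X, ℝ)) (hf : f ∈ A₁ ∨ f ∈ A₂) :
    |(1 / n : ℝ) * ∑ i ∈ Finset.range n, (-1 : ℝ) ^ i * f (x i)| ≤ (2 / n : ℝ) * ‖f‖ := by
  have key : |∑ i ∈ Finset.range n, (-1 : ℝ) ^ i * f (x i)| ≤ 2 * ‖f‖ := by
    refine abs_alternating_sum_le (a := fun i => f (x i)) hn (fun i => f.norm_coe_le_norm (x i)) ?_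
    rcases hbolt.2 with h | h <;> rcases hf with hf | hf
    · exact Or.inl fun i hi he => by have := h i hi; rw [if_pos he] at this; exact this f hf
    · exact Or.inr fun i hi he => by have := h i hi; rw [if_neg he] at this; exact this f hf
    · exact Or.inr fun i hi he => by have := h i hi; rw [if_neg he] at this; exact this f hf
    · exact Or.inl fun i hi he => by have := h i hi; rw [if_pos he] at this; exact this f hf
  rw [abs_mul, abs_of_nonneg (by positivity : (0 : ℝ) ≤ 1 / n)]
  calc (1 / n : ℝ) * |∑ i ∈ Finset.range n, (-1 : ℝ) ^ i * f (x i)|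
      ≤ (1 / n : ℝ) * (2 * ‖f‖) := by gcongr
    _ = (2 / n : ℝ) * ‖f‖ := by ring
end

section
/- Let Q ⊆ ℝ² be a compact convex set with the property that there exists a fixed number N such that any bolt in Q with respect to the coordinate projections can be made closed by adding at most N points of Q. Let A₁ = {f(x) : f continuous on the projection of Q onto the x-axis} and A₂ = {g(y) : g continuous on the projection of Q onto the y-axis}, viewed as subalgebras of C(Q). Then for every h ∈ C(Q), the sequence h₁ = h, h₂ₙ = h₂ₙ₋₁ − F h₂ₙ₋₁, h₂ₙ₊₁ = h₂ₙ − G h₂ₙ satisfies lim_{n→∞} ‖hₙ‖ = E(h) = inf_{w ∈ A₁+A₂} ‖h − w‖. -/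
open Filter Topology

/-- Two points of `Q` share the same first coordinate (`s u = s v`). -/
def sRelQ {Q : Set (ℝ × ℝ)} (u v : Q) : Prop := (u : ℝ × ℝ).1 = (v : ℝ × ℝ).1

/-- Two points of `Q` share the same second coordinate (`p u = p v`). -/
def pRelQ {Q : Set (ℝ × ℝ)} (u v : Q) : Prop := (u : ℝ × ℝ).2 = (v : ℝ × ℝ).2

/-- A bolt in `Q` with respect to the coordinate projections: a finite ordered set of
points with consecutive points distinct, consecutive points alternately sharing the
same first coordinate or the same second coordinate. -/
def IsBoltQ (Q : Set (ℝ × ℝ)) (n : ℕ) (x : ℕ → Q) : Prop :=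
  (∀ i, i + 1 < n → x i ≠ x (i + 1)) ∧
  ((∀ i, i + 1 < n → if Even i then sRelQ (x i) (x (i + 1)) else pRelQ (x i) (x (i + 1))) ∨
   (∀ i, i + 1 < n → if Even i then pRelQ (x i) (x (i + 1)) else sRelQ (x i) (x (i + 1))))

/-- A closed bolt in `Q`: a bolt with an even number of points which remains a bolt
when its first point is appended again at the end. -/
def IsClosedBoltQ (Q : Set (ℝ × ℝ)) (n : ℕ) (x : ℕ → Q) : Prop :=
  IsBoltQ Q n x ∧ Even n ∧ IsBoltQ Q (n + 1) (fun i => if i < n then x i else x 0)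

/-- The levelling operator `F`:
`(F h)(x) = ½ (max{h(x,y) : (x,y) ∈ Q} + min{h(x,y) : (x,y) ∈ Q})`, a function of the
first coordinate alone. -/
noncomputable def FQ {Q : Set (ℝ × ℝ)} (h : Q → ℝ) (u : Q) : ℝ :=
  (sSup (h '' {v | (v : ℝ × ℝ).1 = (u : ℝ × ℝ).1}) +
   sInf (h '' {v | (v : ℝ × ℝ).1 = (u : ℝ × ℝ).1})) / 2

/-- The levelling operator `G`:
`(G h)(y) = ½ (max{h(x,y) : (x,y) ∈ Q} + min{h(x,y) : (x,y) ∈ Q})`, a function of the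
second coordinate alone. -/
noncomputable def GQ {Q : Set (ℝ × ℝ)} (h : Q → ℝ) (u : Q) : ℝ :=
  (sSup (h '' {v | (v : ℝ × ℝ).2 = (u : ℝ × ℝ).2}) +
   sInf (h '' {v | (v : ℝ × ℝ).2 = (u : ℝ × ℝ).2})) / 2

/-- The levelling of `h` along the fibres of `π`: the mean of the supremum and the infimum of `h`
over the fibre through `u`. -/
noncomputable def levelling {X : Type*} (π h : X → ℝ) (u : X) : ℝ :=
  (sSup (h '' {v | π v = π u}) + sInf (h '' {v | π v = π u})) / 2

lemma levelling_congr {X : Type*} {π h : X → ℝ} {u v : X} (huv : π u = π v) :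
    levelling π h u = levelling π h v := by
  simp only [levelling, huv]

section Levelling

variable {X : Type*} [TopologicalSpace X] [CompactSpace X] {π h : X → ℝ}

lemma isCompact_fibre (hπ : Continuous π) (a : ℝ) : IsCompact {v | π v = a} :=
  (isClosed_eq hπ continuous_const).isCompact

/-- On the fibre through `u`, the function `h` attains its extreme values, and the levelling is
their mean. -/
lemma exists_levelling_eq (hπ : Continuous π) (hh : Continuous h) (u : X) :
    ∃ v w, π v = π u ∧ π w = π u ∧ (∀ z, π z = π u → h w ≤ h z ∧ h z ≤ h v) ∧
      levelling π h u = (h v + h w) / 2 := by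
  have hne : {v | π v = π u}.Nonempty := ⟨u, rfl⟩
  obtain ⟨v, hv, hvS, hvle⟩ :=
    (isCompact_fibre hπ (π u)).exists_sSup_image_eq_and_ge hne hh.continuousOn
  obtain ⟨w, hw, hwI, hwle⟩ :=
    (isCompact_fibre hπ (π u)).exists_sInf_image_eq_and_le hne hh.continuousOn
  exact ⟨v, w, hv, hw, fun z hz => ⟨hwle z hz, hvle z hz⟩, by rw [levelling, hvS, hwI]⟩

/-- After levelling, every value is matched by one of opposite sign and at least the same size on
the same fibre. -/
lemma exists_opposite_of_levelling (hπ : Continuous π) (hh : Continuous h) (s : ℝ) (hs : |s| = 1)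
    (u : X) : ∃ v, π v = π u ∧
      s * (h u - levelling π h u) ≤ -s * (h v - levelling π h v) := by
  obtain ⟨v, w, hv, hw, hz, hl⟩ := exists_levelling_eq hπ hh u
  have hu := hz u rfl
  rcases (abs_eq zero_le_one).1 hs with rfl | rfl
  · exact ⟨w, hw, by rw [levelling_congr hw, hl]; linarith⟩
  · exact ⟨v, hv, by rw [levelling_congr hv, hl]; linarith⟩

lemma abs_sub_levelling_add_abs_levelling_le (hπ : Continuous π) (hh : Continuous h) {K : ℝ}
    (hK : ∀ u, |h u| ≤ K) (u : X) : |h u - levelling π h u| + |levelling π h u| ≤ K := by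
  obtain ⟨v, w, hv, hw, hz, hl⟩ := exists_levelling_eq hπ hh u
  have hu := hz u rfl
  have hKv := abs_le.1 (hK v)
  have hKw := abs_le.1 (hK w)
  rw [hl]
  rcases abs_cases (h u - (h v + h w) / 2) with h1 | h1 <;>
    rcases abs_cases ((h v + h w) / 2) with h2 | h2 <;> linarith

lemma abs_le_iSup_abs (hh : Continuous h) (u : X) : |h u| ≤ ⨆ v, |h v| :=
  le_ciSup (isCompact_range hh.abs).bddAbove u

lemma exists_abs_eq_iSup_abs [Nonempty X] (hh : Continuous h) : ∃ u, |h u| = ⨆ v, |h v| :=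
  (isCompact_range hh.abs).sSup_mem (Set.range_nonempty _)

/-- The fibrewise supremum of a continuous function is continuous if the fibres vary lower
hemicontinuously. -/
lemma continuousOn_sSup_fibre (hπ : Continuous π) (hh : Continuous h)
    (hopen : ∀ u, ∀ U ∈ 𝓝 u, π '' U ∈ 𝓝[Set.range π] (π u)) :
    ContinuousOn (fun a => sSup (h '' {v | π v = a})) (Set.range π) := by
  rintro _ ⟨u, rfl⟩
  have attained : ∀ w, ∃ v, π v = π w ∧ sSup (h '' {v | π v = π w}) = h v ∧
      ∀ z, π z = π w → h z ≤ h v := fun w =>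
    (isCompact_fibre hπ (π w)).exists_sSup_image_eq_and_ge ⟨w, rfl⟩ hh.continuousOn
  refine tendsto_order.2 ⟨fun c hc => ?_, fun c hc => ?_⟩
  · obtain ⟨v, hv, hvS, -⟩ := attained u
    have hcv : c < h v := hvS ▸ hc
    have := hopen v {z | c < h z} (hh.continuousAt.eventually_const_lt hcv)
    rw [hv] at this
    filter_upwards [this]
    rintro _ ⟨z, hz, rfl⟩
    obtain ⟨w, -, hwS, hw⟩ := attained z
    rw [hwS]
    exact lt_of_lt_of_le hz (hw z rfl)
  · obtain ⟨v, hv, hvS, hvle⟩ := attained u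
    have hcl : IsClosed (π '' {z | c ≤ h z}) :=
      ((isClosed_le continuous_const hh).isCompact.image hπ).isClosed
    have hnot : π u ∉ π '' {z | c ≤ h z} := by
      rintro ⟨z, hz, hzu⟩
      exact absurd (hz.trans (hvle z hzu)) (not_le.2 (hvS ▸ hc))
    filter_upwards [mem_nhdsWithin_of_mem_nhds (hcl.isOpen_compl.mem_nhds hnot),
      self_mem_nhdsWithin]
    rintro _ ha ⟨z, rfl⟩
    obtain ⟨w, hw, hwS, -⟩ := attained z
    rw [hwS]
    by_contra! hcw
    exact ha ⟨w, hcw, hw⟩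

lemma exists_continuousOn_levelling_eq (hπ : Continuous π) (hh : Continuous h)
    (hopen : ∀ u, ∀ U ∈ 𝓝 u, π '' U ∈ 𝓝[Set.range π] (π u)) :
    ∃ f : ℝ → ℝ, ContinuousOn f (Set.range π) ∧ ∀ u, levelling π h u = f (π u) := by
  refine ⟨fun a => (sSup (h '' {v | π v = a}) - sSup ((fun v => -h v) '' {v | π v = a})) / 2,
    ((continuousOn_sSup_fibre hπ hh hopen).sub
      (continuousOn_sSup_fibre hπ hh.neg hopen)).div_const 2, fun u => ?_⟩
  have : (fun v => -h v) '' {v | π v = π u} = -(h '' {v | π v = π u}) := by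
    rw [← Set.image_neg_eq_neg, Set.image_image]
  simp only [levelling, this, Real.sInf_def, sub_eq_add_neg]

/-- If the norms of an iterated levelling converge to `M`, then there are arbitrarily long
alternating chains on which the late iterates take values close to `±M` with alternating signs. -/
lemma eventually_exists_alternating_chain [Nonempty X] {π : ℕ → X → ℝ} {H : ℕ → X → ℝ} {M : ℝ}
    (hπ : ∀ n, Continuous (π n)) (hH : ∀ n, 1 ≤ n → Continuous (H n))
    (hrec : ∀ n, 1 ≤ n → ∀ u, H (n + 1) u = H n u - levelling (π (n + 1)) (H n) u)
    (hM : ∀ n, 1 ≤ n → M ≤ ⨆ u, |H n u|)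
    (hlim : Tendsto (fun n => ⨆ u, |H n u|) atTop (𝓝 M)) (k : ℕ) :
    ∀ ε > 0, ∀ᶠ m in atTop, ∃ (s : ℝ) (x : ℕ → X), |s| = 1 ∧
      (∀ i < k, π (m + i) (x i) = π (m + i) (x (i + 1))) ∧
      ∀ i ≤ k, M - ε ≤ s * (-1) ^ i * H m (x i) := by
  induction k with
  | zero =>
    intro ε hε
    filter_upwards [eventually_ge_atTop 1] with m hm
    obtain ⟨u, hu⟩ := exists_abs_eq_iSup_abs (hH m hm)
    have hMu := hu ▸ hM m hm
    rcases abs_cases (H m u) with ⟨h1, -⟩ | ⟨h1, -⟩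
    · refine ⟨1, fun _ => u, by simp, by simp, fun i hi => ?_⟩
      rw [Nat.le_zero.1 hi]
      linarith
    · refine ⟨-1, fun _ => u, by simp, by simp, fun i hi => ?_⟩
      rw [Nat.le_zero.1 hi]
      linarith
  | succ k ih =>
    intro ε hε
    have hnorm : ∀ᶠ m in atTop, ⨆ u, |H m u| < M + ε / 3 :=
      hlim.eventually_lt_const (by linarith)
    filter_upwards [(tendsto_add_atTop_nat 1).eventually (ih (ε / 3) (by positivity)), hnorm,
      eventually_ge_atTop 2] with m hex hm hm2
    obtain ⟨s, x, hs, hx, hval⟩ := hex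
    have hold : ∀ i ≤ k, M - ε ≤ s * (-1) ^ i * H m (x i) := by
      intro i hi
      have h1 := abs_sub_levelling_add_abs_levelling_le (hπ (m + 1)) (hH m (by omega))
        (fun u => (abs_le_iSup_abs (hH m (by omega)) u).trans hm.le) (x i)
      rw [← hrec m (by omega)] at h1
      have h2 := hval i hi
      have h3 : H m (x i) = H (m + 1) (x i) + levelling (π (m + 1)) (H m) (x i) := by
        rw [hrec m (by omega)]; ring
      have hsi : |s * (-1) ^ i| = 1 := by simp [abs_mul, hs]
      rw [h3]
      generalize levelling (π (m + 1)) (H m) (x i) = l at *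
      rcases (abs_eq zero_le_one).1 hsi with h4 | h4 <;> rw [h4] at h2 ⊢ <;>
        linarith [neg_abs_le l, le_abs_self l, neg_abs_le (H (m + 1) (x i)),
          le_abs_self (H (m + 1) (x i))]
    obtain ⟨m, rfl⟩ : ∃ j, m = j + 1 := ⟨m - 1, by omega⟩
    obtain ⟨z, hz, hzs⟩ :=
      exists_opposite_of_levelling (hπ (m + 1)) (hH m (by omega)) s hs (x 0)
    rw [← hrec m (by omega), ← hrec m (by omega)] at hzs
    refine ⟨-s, fun i => Nat.casesOn i z x, by rwa [abs_neg], ?_, ?_⟩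
    · rintro (_ | i) hi
      · exact hz
      · have := hx i (by omega)
        rwa [show m + 1 + 1 + i = m + 1 + (i + 1) by ring] at this
    · rintro (_ | i) hi
      · have := hold 0 (by omega)
        rw [pow_zero, mul_one] at this ⊢
        exact this.trans hzs
      · have := hold i (by omega)
        rw [pow_succ]
        simp only at this ⊢
        linarith

end Levelling

/-- A linear functional restricted to a convex set is open onto its image, on one side. -/
lemma Convex.image_mem_nhdsWithin_Ici {E : Type*} [NormedAddCommGroup E] [NormedSpace ℝ E]
    {Q : Set E} (hQ : Convex ℝ Q) (l : E →L[ℝ] ℝ) (u : Q) {U : Set Q} (hU : U ∈ 𝓝 u) :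
    (fun v : Q => l v) '' U ∈ 𝓝[Set.range (fun v : Q => l v) ∩ Set.Ici (l u)] (l u) := by
  by_cases hv : ∃ v : Q, l u < l v
  · obtain ⟨v, hv⟩ := hv
    obtain ⟨W, hW, hWU⟩ := mem_nhds_subtype _ _ _ |>.1 hU
    let p : ℝ → E := fun a => (u : E) + ((a - l u) / (l v - l u)) • ((v : E) - u)
    have hp : Continuous p := by fun_prop
    have hpu : p (l u) = u := by simp [p]
    have hpW : ∀ᶠ a in 𝓝 (l u), p a ∈ W := hp.continuousAt (by rwa [hpu])
    filter_upwards [mem_nhdsWithin_of_mem_nhds hpW,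
      mem_nhdsWithin_of_mem_nhds (Iio_mem_nhds hv), self_mem_nhdsWithin] with a ha hav hau
    have hpos : 0 < l v - l u := sub_pos.2 hv
    have hpQ : p a ∈ Q := hQ.add_smul_sub_mem u.2 v.2
      ⟨div_nonneg (sub_nonneg.2 hau.2) hpos.le,
        (div_le_one hpos).2 (sub_le_sub_right (le_of_lt hav) _)⟩
    refine ⟨⟨p a, hpQ⟩, hWU ha, ?_⟩
    simp only [p, map_add, map_smul, map_sub, smul_eq_mul]
    field_simp
    ring
  · push Not at hv
    filter_upwards [self_mem_nhdsWithin]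
    rintro _ ⟨⟨v, rfl⟩, hvu⟩
    exact ⟨u, mem_of_mem_nhds hU, le_antisymm hvu (hv v)⟩

lemma Convex.image_mem_nhdsWithin_range {E : Type*} [NormedAddCommGroup E] [NormedSpace ℝ E]
    {Q : Set E} (hQ : Convex ℝ Q) (l : E →L[ℝ] ℝ) (u : Q) {U : Set Q} (hU : U ∈ 𝓝 u) :
    (fun v : Q => l v) '' U ∈ 𝓝[Set.range (fun v : Q => l v)] (l u) := by
  have h1 := hQ.image_mem_nhdsWithin_Ici l u hU
  have h2 := hQ.image_mem_nhdsWithin_Ici (-l) u hU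
  rw [mem_nhdsWithin_iff_eventually] at h1 h2 ⊢
  have h3 := (continuous_neg.tendsto (l u)).eventually h2
  filter_upwards [h1, h3] with a ha hb har
  obtain ⟨v, rfl⟩ := har
  rcases le_total (l u) (l v) with h4 | h4
  · exact ha ⟨⟨v, rfl⟩, h4⟩
  · obtain ⟨w, hw, hwv⟩ := hb ⟨⟨v, rfl⟩, neg_le_neg h4⟩
    exact ⟨w, hw, neg_injective hwv⟩

lemma sum_range_two_mul_alternating_eq_zero_of_eq {a : ℕ → ℝ} (k : ℕ)
    (ha : ∀ j < k, a (2 * j) = a (2 * j + 1)) :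
    ∑ i ∈ Finset.range (2 * k), (-1) ^ i * a i = 0 := by
  induction k with
  | zero => simp
  | succ k ih =>
    rw [show 2 * (k + 1) = 2 * k + 1 + 1 by ring, Finset.sum_range_succ, Finset.sum_range_succ,
      ih fun j hj => ha j (by omega), ha k (by omega)]
    simp [pow_succ]

lemma sum_range_two_mul_alternating_eq_sub {a : ℕ → ℝ} (k : ℕ)
    (ha : ∀ j < k, a (2 * j + 1) = a (2 * j + 2)) :
    ∑ i ∈ Finset.range (2 * k), (-1) ^ i * a i = a 0 - a (2 * k) := by
  induction k with
  | zero => simp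
  | succ k ih =>
    rw [show 2 * (k + 1) = 2 * k + 1 + 1 by ring, Finset.sum_range_succ, Finset.sum_range_succ,
      ih fun j hj => ha j (by omega), ha k (by omega)]
    simp [pow_succ, sub_eq_add_neg]

/-- Alternating sums over closed bolts annihilate sums of univariate functions. -/
lemma IsClosedBoltQ.sum_alternating_eq_zero {Q : Set (ℝ × ℝ)} {n : ℕ} {y : ℕ → Q}
    (hy : IsClosedBoltQ Q n y) (f g : ℝ → ℝ) :
    ∑ i ∈ Finset.range n, (-1) ^ i * (f (y i : ℝ × ℝ).1 + g (y i : ℝ × ℝ).2) = 0 := by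
  obtain ⟨-, hn, -, hz⟩ := hy
  obtain ⟨k, rfl⟩ := even_iff_exists_two_mul.1 hn
  set z : ℕ → Q := fun i => if i < 2 * k then y i else y 0 with hzdef
  have hyz : ∀ i ∈ Finset.range (2 * k), y i = z i := fun i hi => by
    simp [hzdef, Finset.mem_range.1 hi]
  have hwrap : z 0 = z (2 * k) := by simp [hzdef]
  rw [Finset.sum_congr rfl fun i hi => by rw [hyz i hi, mul_add], Finset.sum_add_distrib]
  have ho : ∀ j, ¬ Even (2 * j + 1) := fun j => by simp
  rcases hz with hz | hz
  · rw [sum_range_two_mul_alternating_eq_zero_of_eq (a := fun i => f (z i : ℝ × ℝ).1),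
      sum_range_two_mul_alternating_eq_sub (a := fun i => g (z i : ℝ × ℝ).2), hwrap]
    · simp
    · intro j hj
      have := hz (2 * j + 1) (by omega)
      rw [if_neg (ho j)] at this
      exact congrArg g this
    · intro j hj
      have := hz (2 * j) (by omega)
      rw [if_pos (even_two_mul j)] at this
      exact congrArg f this
  · rw [sum_range_two_mul_alternating_eq_sub (a := fun i => f (z i : ℝ × ℝ).1),
      sum_range_two_mul_alternating_eq_zero_of_eq (a := fun i => g (z i : ℝ × ℝ).2), hwrap]
    · simp
    · intro j hj
      have := hz (2 * j) (by omega)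
      rw [if_pos (even_two_mul j)] at this
      exact congrArg g this
    · intro j hj
      have := hz (2 * j + 1) (by omega)
      rw [if_neg (ho j)] at this
      exact congrArg f this

/-- Closing up a bolt on which `H` alternates between values beyond `±c` bounds the distance of
`H` to the sums of univariate functions from below. -/
lemma IsBoltQ.mul_le_of_alternating {Q : Set (ℝ × ℝ)} {N n : ℕ}
    (hclose : ∀ (n : ℕ) (x : ℕ → Q), IsBoltQ Q n x →
      ∃ m ≤ N, ∃ y : ℕ → Q, (∀ i < n, y i = x i) ∧ IsClosedBoltQ Q (n + m) y)
    {x : ℕ → Q} (hx : IsBoltQ Q n x) {H : Q → ℝ} {f g : ℝ → ℝ} {s c K r : ℝ} (hs : |s| = 1)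
    (hc : ∀ i < n, c ≤ s * (-1) ^ i * H (x i)) (hK : ∀ u, |H u| ≤ K) (hK0 : 0 ≤ K)
    (hr : ∀ u : Q, |H u - (f (u : ℝ × ℝ).1 + g (u : ℝ × ℝ).2)| ≤ r) (hr0 : 0 ≤ r) :
    n * (c - r) ≤ N * (K + r) := by
  obtain ⟨m, hm, y, hyx, hy⟩ := hclose n x hx
  have hsign : ∀ i : ℕ, ∀ t : ℝ, |s * (-1) ^ i * t| = |t| := fun i t => by
    simp [abs_mul, hs]
  have hupper : ∑ i ∈ Finset.range (n + m), s * (-1) ^ i * H (y i) ≤ (n + m) * r := by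
    calc ∑ i ∈ Finset.range (n + m), s * (-1) ^ i * H (y i)
        = ∑ i ∈ Finset.range (n + m), s * (-1) ^ i *
            (H (y i) - (f (y i : ℝ × ℝ).1 + g (y i : ℝ × ℝ).2)) +
          s * ∑ i ∈ Finset.range (n + m),
            (-1) ^ i * (f (y i : ℝ × ℝ).1 + g (y i : ℝ × ℝ).2) := by
          rw [Finset.mul_sum, ← Finset.sum_add_distrib]
          exact Finset.sum_congr rfl fun i _ => by ring
      _ = ∑ i ∈ Finset.range (n + m), s * (-1) ^ i *
            (H (y i) - (f (y i : ℝ × ℝ).1 + g (y i : ℝ × ℝ).2)) := by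
          rw [hy.sum_alternating_eq_zero, mul_zero, add_zero]
      _ ≤ ∑ i ∈ Finset.range (n + m), r :=
          Finset.sum_le_sum fun i _ => (le_abs_self _).trans ((hsign i _).trans_le (hr _))
      _ = (n + m) * r := by simp
  have hlower : n * c - m * K ≤ ∑ i ∈ Finset.range (n + m), s * (-1) ^ i * H (y i) := by
    rw [Finset.sum_range_add]
    have h1 : n * c ≤ ∑ i ∈ Finset.range n, s * (-1) ^ i * H (y i) := by
      calc n * c = ∑ i ∈ Finset.range n, c := by simp
        _ ≤ _ := Finset.sum_le_sum fun i hi => by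
          rw [hyx i (Finset.mem_range.1 hi)]
          exact hc i (Finset.mem_range.1 hi)
    have h2 : m * -K ≤ ∑ i ∈ Finset.range m, s * (-1) ^ (n + i) * H (y (n + i)) := by
      calc m * -K = ∑ i ∈ Finset.range m, -K := by simp
        _ ≤ _ := Finset.sum_le_sum fun i _ =>
          (abs_le.1 ((hsign (n + i) _).trans_le (hK _))).1
    linarith
  have : (m : ℝ) * (K + r) ≤ N * (K + r) := by gcongr
  linarith

/-- Corollary 2.4. Let `Q ⊆ ℝ²` be compact convex such that for some
fixed `N`, any bolt in `Q` (with respect to the coordinate projections) can be made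
closed by adding at most `N` points of `Q`.  Let `A₁` (resp. `A₂`) consist of the
continuous functions of the first (resp. second) coordinate alone.  Then for every
`h ∈ C(Q)` the Diliberto–Straus iteration `h₁ = h`, `h₂ₙ = h₂ₙ₋₁ − F h₂ₙ₋₁`,
`h₂ₙ₊₁ = h₂ₙ − G h₂ₙ` satisfies `lim ‖hₙ‖ = E(h) = inf_{w ∈ A₁+A₂} ‖h − w‖`. -/
theorem stmt16 (Q : Set (ℝ × ℝ)) (hQc : IsCompact Q) (hQconv : Convex ℝ Q)
    (N : ℕ)
    (hclose : ∀ (n : ℕ) (x : ℕ → Q), IsBoltQ Q n x →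
      ∃ m ≤ N, ∃ y : ℕ → Q, (∀ i < n, y i = x i) ∧ IsClosedBoltQ Q (n + m) y)
    (h : Q → ℝ) (hh : Continuous h)
    (hseq : ℕ → Q → ℝ) (h1 : hseq 1 = h)
    (heven : ∀ n, 1 ≤ n → ∀ u,
      hseq (2 * n) u = hseq (2 * n - 1) u - FQ (hseq (2 * n - 1)) u)
    (hodd : ∀ n, 1 ≤ n → ∀ u,
      hseq (2 * n + 1) u = hseq (2 * n) u - GQ (hseq (2 * n)) u) :
    Tendsto (fun n => ⨆ u : Q, |hseq n u|) atTop
      (𝓝 (sInf {r : ℝ | ∃ f g : ℝ → ℝ, ContinuousOn f (Prod.fst '' Q) ∧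
        ContinuousOn g (Prod.snd '' Q) ∧
        r = ⨆ u : Q, |h u - f (u : ℝ × ℝ).1 - g (u : ℝ × ℝ).2|})) := by
  rcases isEmpty_or_nonempty Q with hE | hE
  · simp only [Real.iSup_of_isEmpty]
    have : {r : ℝ | ∃ f g : ℝ → ℝ, ContinuousOn f (Prod.fst '' Q) ∧
        ContinuousOn g (Prod.snd '' Q) ∧ r = 0} = {0} := by
      ext r
      exact ⟨fun ⟨_, _, _, _, hr⟩ => hr,
        fun hr => ⟨0, 0, continuousOn_const, continuousOn_const, hr⟩⟩
    rw [this, csInf_singleton]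
    exact tendsto_const_nhds
  have : CompactSpace Q := isCompact_iff_compactSpace.1 hQc
  set S := {r : ℝ | ∃ f g : ℝ → ℝ, ContinuousOn f (Prod.fst '' Q) ∧
        ContinuousOn g (Prod.snd '' Q) ∧
        r = ⨆ u : Q, |h u - f (u : ℝ × ℝ).1 - g (u : ℝ × ℝ).2|}
  have hfst : Continuous fun u : Q => (u : ℝ × ℝ).1 := by fun_prop
  have hsnd : Continuous fun u : Q => (u : ℝ × ℝ).2 := by fun_prop
  have hcont : ∀ f g : ℝ → ℝ, ContinuousOn f (Prod.fst '' Q) → ContinuousOn g (Prod.snd '' Q) →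
      Continuous fun u : Q => h u - f (u : ℝ × ℝ).1 - g (u : ℝ × ℝ).2 := fun f g hf hg =>
    (hh.sub (hf.comp_continuous hfst fun u => ⟨u, u.2, rfl⟩)).sub
      (hg.comp_continuous hsnd fun u => ⟨u, u.2, rfl⟩)
  let π : ℕ → Q → ℝ := fun n u => if Even n then (u : ℝ × ℝ).1 else (u : ℝ × ℝ).2
  have hπe : ∀ {n}, Even n → π n = fun u : Q => (u : ℝ × ℝ).1 := fun hn => by
    funext u; exact if_pos hn
  have hπo : ∀ {n}, ¬ Even n → π n = fun u : Q => (u : ℝ × ℝ).2 := fun hn => by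
    funext u; exact if_neg hn
  have hπ : ∀ n, Continuous (π n) := fun n => by
    by_cases hn : Even n
    · rwa [hπe hn]
    · rwa [hπo hn]
  have hrec : ∀ n, 1 ≤ n → ∀ u,
      hseq (n + 1) u = hseq n u - levelling (π (n + 1)) (hseq n) u := by
    intro n hn u
    rcases Nat.even_or_odd' n with ⟨k, rfl | rfl⟩
    · rw [hπo (by simp)]
      exact hodd k (by omega) u
    · rw [hπe (by simp [parity_simps])]
      exact heven (k + 1) (by omega) u
  have hdecomp : ∀ n, 1 ≤ n → ∃ f g : ℝ → ℝ, ContinuousOn f (Prod.fst '' Q) ∧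
      ContinuousOn g (Prod.snd '' Q) ∧
      hseq n = fun u => h u - f (u : ℝ × ℝ).1 - g (u : ℝ × ℝ).2 := by
    intro n hn
    induction n, hn using Nat.le_induction with
    | base => exact ⟨0, 0, continuousOn_const, continuousOn_const, by simp [h1]⟩
    | succ n hn ih =>
      obtain ⟨f, g, hf, hg, hfg⟩ := ih
      have hHc : Continuous (hseq n) := hfg ▸ hcont f g hf hg
      by_cases hev : Even (n + 1)
      · obtain ⟨p, hp, hpl⟩ := exists_continuousOn_levelling_eq hfst hHc fun u U hU =>
          hQconv.image_mem_nhdsWithin_range (ContinuousLinearMap.fst ℝ ℝ ℝ) u hU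
        rw [← Set.image_eq_range] at hp
        refine ⟨fun a => f a + p a, g, hf.add hp, hg, ?_⟩
        funext u
        rw [hrec n hn, hπe hev, hpl, hfg]
        ring
      · obtain ⟨p, hp, hpl⟩ := exists_continuousOn_levelling_eq hsnd hHc fun u U hU =>
          hQconv.image_mem_nhdsWithin_range (ContinuousLinearMap.snd ℝ ℝ ℝ) u hU
        rw [← Set.image_eq_range] at hp
        refine ⟨f, fun a => g a + p a, hf, hg.add hp, ?_⟩
        funext u
        rw [hrec n hn, hπo hev, hpl, hfg]
        ring
  have hHc : ∀ n, 1 ≤ n → Continuous (hseq n) := fun n hn => by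
    obtain ⟨f, g, hf, hg, hfg⟩ := hdecomp n hn
    exact hfg ▸ hcont f g hf hg
  let K : ℕ → ℝ := fun n => ⨆ u : Q, |hseq n u|
  have hK0 : ∀ n, 0 ≤ K n := fun n => Real.iSup_nonneg fun u => abs_nonneg _
  have hanti : Antitone fun n => K (n + 1) := antitone_nat_of_succ_le fun n =>
    ciSup_le fun u => by
      have := abs_sub_levelling_add_abs_levelling_le (hπ (n + 1 + 1)) (hHc (n + 1) (by omega))
        (abs_le_iSup_abs (hHc (n + 1) (by omega))) u
      rw [← hrec (n + 1) (by omega)] at this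
      exact (le_add_of_nonneg_right (abs_nonneg _)).trans this
  obtain ⟨M, hM⟩ : ∃ M, Tendsto (fun n => K (n + 1)) atTop (𝓝 M) :=
    ⟨_, tendsto_atTop_ciInf hanti ⟨0, by rintro _ ⟨n, rfl⟩; exact hK0 _⟩⟩
  have hlim : Tendsto K atTop (𝓝 M) := (tendsto_add_atTop_iff_nat 1).1 hM
  have hMK : ∀ n, 1 ≤ n → M ≤ K n := fun n hn => by
    obtain ⟨j, rfl⟩ : ∃ j, n = j + 1 := ⟨n - 1, by omega⟩
    exact hanti.le_of_tendsto hM j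
  have hS0 : ∀ r ∈ S, 0 ≤ r := by
    rintro _ ⟨f, g, -, -, rfl⟩
    exact Real.iSup_nonneg fun u => abs_nonneg _
  have hKS : ∀ n, 1 ≤ n → K n ∈ S := fun n hn => by
    obtain ⟨f, g, hf, hg, hfg⟩ := hdecomp n hn
    exact ⟨f, g, hf, hg, by simp only [K, hfg]⟩
  suffices hMS : M = sInf S by rw [← hMS]; exact hlim
  refine le_antisymm (le_csInf ⟨_, hKS 1 le_rfl⟩ fun r hrS => ?_)
    (ge_of_tendsto hlim ((eventually_ge_atTop 1).mono fun n hn =>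
      csInf_le ⟨0, hS0⟩ (hKS n hn)))
  have hr0 := hS0 r hrS
  obtain ⟨f, g, hf, hg, hr⟩ := hrS
  by_contra! hrM
  obtain ⟨k, hk⟩ := exists_nat_gt (N * (K 1 + r) / ((M - r) / 2))
  have hgap : 0 < (M - r) / 2 := by linarith
  rw [div_lt_iff₀ hgap] at hk
  obtain ⟨m, hme, ⟨s, x, hs, hx, hval⟩, hm1⟩ := (Nat.frequently_even.and_eventually
    ((eventually_exists_alternating_chain hπ hHc hrec hMK hlim k _ hgap).and
      (eventually_ge_atTop 1))).exists
  have hbolt : IsBoltQ Q (k + 1) x := by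
    refine ⟨fun i hi hxi => ?_, Or.inl fun i hi => ?_⟩
    · have h2 := hval i (by omega)
      have h3 := hval (i + 1) (by omega)
      rw [← hxi, pow_succ] at h3
      linarith
    · have := hx i (by omega)
      split_ifs with hi
      · rwa [hπe (hme.add hi)] at this
      · rwa [hπo (by simpa [hme, parity_simps] using hi)] at this
  obtain ⟨p, q, hp, hq, hpq⟩ := hdecomp m hm1
  have key := hbolt.mul_le_of_alternating hclose (H := hseq m) (f := fun a => f a - p a)
    (g := fun b => g b - q b) (K := K 1) (r := r) hs (fun i hi => hval i (by omega))
    (fun u => (abs_le_iSup_abs (hHc m hm1) u).trans (by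
      obtain ⟨j, rfl⟩ : ∃ j, m = j + 1 := ⟨m - 1, by omega⟩
      exact hanti (Nat.zero_le j))) (hK0 1)
    (fun u => by
      rw [hr, hpq]
      convert abs_le_iSup_abs (hcont f g hf hg) u using 2
      ring) hr0
  push_cast at key
  linarith
end
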